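/- Let c : ℝ × ℝ → ℝ ∪ {+∞} be a cost function such that: (i) its domain D is convex; (ii) c is ⊖-monotone; (iii) for every (x,y) ∈ D there exist δ > 0 and a finite constant bounding c from above on the open ball of radius δ around (x,y); (iv) for every boundary point (x,y) of D, c(x_k,y_k) → +∞ whenever (x_k,y_k) is a sequence converging to (x,y). Let G be a nonempty subset of D such that: (v) G is c-path bounded; (vi) for every partition of G into two nonempty sets S₁, S₂ there exist (x,y) ∈ S₁ and (u,v) ∈ S₂ such that there is a path in G from (x,y) to (u,v) or a path in G from (u,v) to (x,y). Then there exists a set S with G ⊆ S ⊆ D such that S is c-path bounded and strongly connected (every two points of S are strongly connected), and G has a c-antiderivative. -/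

import Mathlib

open scoped BigOperators

namespace Paper

variable {X Y : Type*}

/-- The domain of the cost `c`, i.e. the set where `c` is finite. -/
def Dom (c : X × Y → EReal) : Set (X × Y) := {p | c p < ⊤}

/-- `z` is a path in `G` from `p` to `q` (with `N` steps). -/
def IsPath (c : X × Y → EReal) (G : Set (X × Y)) (p q : X × Y)
    (N : ℕ) (z : Fin (N + 1) → X × Y) : Prop :=
  (∀ k, z k ∈ G) ∧ z 0 = p ∧ z (Fin.last N) = q ∧
    ∀ k : Fin N, c ((z k.succ).1, (z k.castSucc).2) < ⊤

/-- The inner variation `∑_{k=1}^N (c(x_k,y_k) − c(x_{k+1},y_k))` along a path; all the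
terms involved are finite for a path in `G ⊆ Dom c`, so the real-valued sum is faithful. -/
noncomputable def pathSum (c : X × Y → EReal) {N : ℕ} (z : Fin (N + 1) → X × Y) : ℝ :=
  ∑ k : Fin N, ((c (z k.castSucc)).toReal - (c ((z k.succ).1, (z k.castSucc).2)).toReal)

/-- The maximal inner variation `F_G(p,q)`, with the convention `sSup ∅ = ⊥ = −∞`. -/
noncomputable def innerVar (c : X × Y → EReal) (G : Set (X × Y)) (p q : X × Y) : EReal :=
  sSup {s : EReal | ∃ (N : ℕ) (z : Fin (N + 1) → X × Y),
    IsPath c G p q N z ∧ s = ((pathSum c z : ℝ) : EReal)}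

/-- `G` is `c`-path bounded. -/
def PathBounded (c : X × Y → EReal) (G : Set (X × Y)) : Prop :=
  ∀ p ∈ G, ∀ q ∈ G, innerVar c G p q < ⊤

/-- `G` is `c`-cyclically monotone. -/
def CyclicallyMonotone (c : X × Y → EReal) (G : Set (X × Y)) : Prop :=
  ∀ p ∈ G, innerVar c G p p ≤ 0

/-- `f` is a `c`-antiderivative of `G`:
`c(x,y) − c(u,y) ≤ f(x,y) − f(u,v)` in `[−∞,+∞]` for all `(x,y),(u,v) ∈ G`. -/
def IsAntideriv (c : X × Y → EReal) (G : Set (X × Y)) (f : X × Y → ℝ) : Prop :=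
  ∀ p ∈ G, ∀ q ∈ G, c p - c (q.1, p.2) ≤ (f p : EReal) - (f q : EReal)

/-- `p` and `q` are strongly connected (mutually reachable by paths) in `G`. -/
def StronglyConn (c : X × Y → EReal) (G : Set (X × Y)) (p q : X × Y) : Prop :=
  (∃ N z, IsPath c G p q N z) ∧ (∃ N z, IsPath c G q p N z)

/-- The ℓ²-product distance `√(d_X(x,u)² + d_Y(y,v)²)` on `X × Y`. -/
noncomputable def dist2 [PseudoMetricSpace X] [PseudoMetricSpace Y] (p q : X × Y) : ℝ :=
  Real.sqrt (dist p.1 q.1 ^ 2 + dist p.2 q.2 ^ 2)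

/-- The open ball for the ℓ²-product distance. -/
def ball2 [PseudoMetricSpace X] [PseudoMetricSpace Y] (p : X × Y) (r : ℝ) : Set (X × Y) :=
  {q | dist2 p q < r}

/-- The maximal open ball centered at `p` contained in `Dom c`, i.e. `B_{ρ(p)}(p)` where
`ρ(p) = sup {r > 0 | B_r(p) ⊆ Dom c}`; note `dist2 p q < ρ(p)` iff there exists `r > 0`
with `B_r(p) ⊆ Dom c` and `dist2 p q < r`. -/
def MaxBall [PseudoMetricSpace X] [PseudoMetricSpace Y]
    (c : X × Y → EReal) (p : X × Y) : Set (X × Y) :=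
  {q | ∃ r : ℝ, 0 < r ∧ ball2 p r ⊆ Dom c ∧ dist2 p q < r}

/-- `z` is a ball chain in `G` from `p` to `q`. -/
def IsBallChain [PseudoMetricSpace X] [PseudoMetricSpace Y]
    (c : X × Y → EReal) (G : Set (X × Y)) (p q : X × Y)
    (N : ℕ) (z : Fin (N + 1) → X × Y) : Prop :=
  (∀ k, z k ∈ G) ∧ z 0 = p ∧ z (Fin.last N) = q ∧
    ∀ k : Fin N, (MaxBall c (z k.castSucc) ∩ MaxBall c (z k.succ) ∩ G).Nonempty

/-- The order `(x,y) ≼⊖ (u,v) ⟺ x ≤ u ∧ y ≥ v` on `ℝ × ℝ`. -/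
def leOminus (p q : ℝ × ℝ) : Prop := p.1 ≤ q.1 ∧ q.2 ≤ p.2

/-- `S` is a `≼⊖`-chain. -/
def OminusChain (S : Set (ℝ × ℝ)) : Prop :=
  ∀ p ∈ S, ∀ q ∈ S, leOminus p q ∨ leOminus q p

/-- The cost `c` is `⊖`-monotone. -/
def OminusMonotone (c : ℝ × ℝ → EReal) : Prop :=
  ∀ p q : ℝ × ℝ, p ∈ Dom c → q ∈ Dom c →
    c p - c (q.1, p.2) + (c q - c (p.1, q.2)) ≤ 0 →
    (leOminus p q ∨ leOminus q p)

section Paths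

variable {c : X × Y → EReal} {G : Set (X × Y)} {p q r : X × Y} {s t : ℝ}

/-- `s` is the inner variation of some path in `G` from `p` to `q`. -/
def IsPathValue (c : X × Y → EReal) (G : Set (X × Y)) (p q : X × Y) (s : ℝ) : Prop :=
  ∃ (N : ℕ) (z : Fin (N + 1) → X × Y), IsPath c G p q N z ∧ pathSum c z = s

theorem IsPathValue.refl (hp : p ∈ G) : IsPathValue c G p p 0 :=
  ⟨0, fun _ => p, ⟨fun _ => hp, rfl, rfl, fun k => k.elim0⟩, by simp [pathSum]⟩

theorem IsPathValue.cons (hp : p ∈ G) (hpq : c (q.1, p.2) < ⊤) (h : IsPathValue c G q r s) :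
    IsPathValue c G p r ((c p).toReal - (c (q.1, p.2)).toReal + s) := by
  obtain ⟨N, z, ⟨hG, h0, hl, hstep⟩, rfl⟩ := h
  refine ⟨N + 1, Fin.cons p z, ⟨?_, rfl, ?_, ?_⟩, ?_⟩
  · intro k
    cases k using Fin.cases with
    | zero => exact hp
    | succ k => exact hG k
  · rw [← Fin.succ_last, Fin.cons_succ, hl]
  · intro k
    cases k using Fin.cases with
    | zero => simpa [h0] using hpq
    | succ k => simpa using hstep k
  · simp [pathSum, Fin.sum_univ_succ (n := N), h0]

theorem IsPathValue.step (hp : p ∈ G) (hq : q ∈ G) (hpq : c (q.1, p.2) < ⊤) :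
    IsPathValue c G p q ((c p).toReal - (c (q.1, p.2)).toReal) := by
  simpa using (IsPathValue.refl hq).cons hp hpq

theorem IsPathValue.trans (h : IsPathValue c G p q s) (h' : IsPathValue c G q r t) :
    IsPathValue c G p r (s + t) := by
  obtain ⟨N, z, hz, rfl⟩ := h
  induction N generalizing p with
  | zero =>
    obtain ⟨-, rfl, rfl, -⟩ := hz
    simpa [pathSum] using h'
  | succ N ih =>
    obtain ⟨hG, rfl, hl, hstep⟩ := hz
    have key := ih (p := z (Fin.succ 0)) (fun k => z k.succ)
      ⟨fun k => hG _, rfl, by simpa using hl, fun k => hstep k.succ⟩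
    have := key.cons (hG 0) (hstep 0)
    convert this using 1
    simp [pathSum, Fin.sum_univ_succ (n := N)]
    ring

theorem StronglyConn.step (hp : p ∈ G) (hq : q ∈ G) (hpq : c (q.1, p.2) < ⊤)
    (hqp : c (p.1, q.2) < ⊤) : StronglyConn c G p q := by
  obtain ⟨N, z, h, -⟩ := IsPathValue.step hp hq hpq
  obtain ⟨N', z', h', -⟩ := IsPathValue.step hq hp hqp
  exact ⟨⟨N, z, h⟩, ⟨N', z', h'⟩⟩

theorem StronglyConn.symm (h : StronglyConn c G p q) : StronglyConn c G q p := ⟨h.2, h.1⟩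

theorem StronglyConn.trans (h : StronglyConn c G p q) (h' : StronglyConn c G q r) :
    StronglyConn c G p r := by
  obtain ⟨⟨N₁, z₁, h₁⟩, ⟨N₂, z₂, h₂⟩⟩ := h
  obtain ⟨⟨N₃, z₃, h₃⟩, ⟨N₄, z₄, h₄⟩⟩ := h'
  obtain ⟨N, z, hz, -⟩ := IsPathValue.trans ⟨N₁, z₁, h₁, rfl⟩ ⟨N₃, z₃, h₃, rfl⟩
  obtain ⟨N', z', hz', -⟩ := IsPathValue.trans ⟨N₄, z₄, h₄, rfl⟩ ⟨N₂, z₂, h₂, rfl⟩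
  exact ⟨⟨N, z, hz⟩, ⟨N', z', hz'⟩⟩

theorem innerVar_lt_top_iff : innerVar c G p q < ⊤ ↔ BddAbove {s | IsPathValue c G p q s} := by
  constructor
  · intro h
    obtain ⟨M, hM, -⟩ := EReal.lt_iff_exists_real_btwn.1 h
    refine ⟨M, ?_⟩
    rintro s ⟨N, z, hz, rfl⟩
    have hle : ((pathSum c z : ℝ) : EReal) ≤ innerVar c G p q := le_sSup ⟨N, z, hz, rfl⟩
    exact EReal.coe_le_coe_iff.1 (hle.trans hM.le)
  · rintro ⟨M, hM⟩
    refine lt_of_le_of_lt (sSup_le ?_) (EReal.coe_lt_top M)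
    rintro _ ⟨N, z, hz, rfl⟩
    exact EReal.coe_le_coe_iff.2 (hM ⟨N, z, hz, rfl⟩)

/-- A path leaving a set has a step leaving it. -/
theorem IsPath.exists_step_notMem {N : ℕ} {z : Fin (N + 1) → X × Y} (h : IsPath c G p q N z)
    {A : Set (X × Y)} (hp : p ∈ A) (hq : q ∉ A) :
    ∃ p' ∈ G, ∃ q' ∈ G, p' ∈ A ∧ q' ∉ A ∧ c (q'.1, p'.2) < ⊤ := by
  obtain ⟨hG, h0, hl, hstep⟩ := h
  by_contra! hcon
  have hall : ∀ k, z k ∈ A := by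
    intro k
    induction k using Fin.induction with
    | zero => rwa [h0]
    | succ k ih =>
      by_contra hk
      exact (hcon _ (hG _) _ (hG _) ih hk).not_gt (hstep k)
  exact hq (hl ▸ hall _)

/-- Closed paths in a path bounded set have nonpositive inner variation. -/
theorem PathBounded.nonpos (h : PathBounded c G) (hp : p ∈ G) (hs : IsPathValue c G p p s) :
    s ≤ 0 := by
  by_contra! hpos
  obtain ⟨M, hM⟩ := innerVar_lt_top_iff.1 (h p hp p hp)
  have hn : ∀ n : ℕ, IsPathValue c G p p (n * s) := by
    intro n
    induction n with
    | zero => simpa using IsPathValue.refl hp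
    | succ n ih =>
      convert ih.trans hs using 1
      push_cast
      ring
  obtain ⟨n, hn'⟩ := exists_nat_gt (M / s)
  rw [div_lt_iff₀ hpos] at hn'
  exact (hM (hn n)).not_gt hn'

/-- A strongly connected path bounded set has an antiderivative. -/
theorem exists_isAntideriv (hbot : ∀ p, c p ≠ ⊥) (hD : G ⊆ Dom c) (h : PathBounded c G)
    (hconn : ∀ p ∈ G, ∀ q ∈ G, StronglyConn c G p q) : ∃ f : X × Y → ℝ, IsAntideriv c G f := by
  rcases G.eq_empty_or_nonempty with rfl | ⟨o, ho⟩
  · exact ⟨0, fun p hp => hp.elim⟩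
  refine ⟨fun p => sSup {s | IsPathValue c G p o s}, fun p hp q hq => ?_⟩
  have hcp : ((c p).toReal : EReal) = c p := EReal.coe_toReal (hD hp).ne (hbot p)
  by_cases htop : c (q.1, p.2) = ⊤
  · rw [htop, EReal.sub_top]
    exact bot_le
  rw [← hcp, ← EReal.coe_toReal htop (hbot _), ← EReal.coe_sub, ← EReal.coe_sub,
    EReal.coe_le_coe_iff, le_sub_comm]
  refine csSup_le ?_ fun s hs => ?_
  · obtain ⟨⟨N, z, hz⟩, -⟩ := hconn q hq o ho
    exact ⟨_, N, z, hz, rfl⟩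
  · have := le_csSup (innerVar_lt_top_iff.1 (h p hp o ho))
      (hs.cons hp (lt_top_iff_ne_top.2 htop))
    linarith

end Paths

section OminusOrder

theorem leOminus.trans {p q r : ℝ × ℝ} (h : leOminus p q) (h' : leOminus q r) : leOminus p r :=
  ⟨h.1.trans h'.1, h'.2.trans h.2⟩

theorem leOminus.antisymm {p q : ℝ × ℝ} (h : leOminus p q) (h' : leOminus q p) : p = q :=
  Prod.ext (le_antisymm h.1 h'.1) (le_antisymm h'.2 h.2)

theorem leOminus.sub_le_sub {p q : ℝ × ℝ} (h : leOminus p q) : p.1 - p.2 ≤ q.1 - q.2 :=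
  _root_.sub_le_sub h.1 h.2

theorem leOminus.left_of_mem_segment {a b r : ℝ × ℝ} (hab : leOminus a b)
    (hr : r ∈ segment ℝ a b) : leOminus a r := by
  obtain ⟨s, ⟨hs0, hs1⟩, rfl⟩ := (segment_eq_image_lineMap ℝ a b).subset hr
  obtain ⟨h1, h2⟩ := hab
  constructor <;> simp [AffineMap.lineMap_apply] <;> nlinarith

theorem leOminus.right_of_mem_segment {a b r : ℝ × ℝ} (hab : leOminus a b)
    (hr : r ∈ segment ℝ a b) : leOminus r b := by
  obtain ⟨s, ⟨hs0, hs1⟩, rfl⟩ := (segment_eq_image_lineMap ℝ a b).subset hr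
  obtain ⟨h1, h2⟩ := hab
  constructor <;> simp [AffineMap.lineMap_apply] <;> nlinarith

theorem leOminus.ominusChain_segment {a b : ℝ × ℝ} (hab : leOminus a b) :
    OminusChain (segment ℝ a b) := by
  intro p hp q hq
  obtain ⟨s, -, rfl⟩ := (segment_eq_image_lineMap ℝ a b).subset hp
  obtain ⟨t, -, rfl⟩ := (segment_eq_image_lineMap ℝ a b).subset hq
  obtain ⟨h1, h2⟩ := hab
  rcases le_total s t with hst | hst
  · left
    constructor <;> simp [AffineMap.lineMap_apply] <;> nlinarith
  · right
    constructor <;> simp [AffineMap.lineMap_apply] <;> nlinarith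

theorem OminusChain.leOminus_of_sub_le {C : Set (ℝ × ℝ)} (hC : OminusChain C) {p q : ℝ × ℝ}
    (hp : p ∈ C) (hq : q ∈ C) (h : p.1 - p.2 ≤ q.1 - q.2) : leOminus p q := by
  rcases hC p hp q hq with h' | h'
  · exact h'
  · obtain ⟨h1, h2⟩ := h'
    constructor <;> linarith

theorem OminusChain.eq_of_sub_eq {C : Set (ℝ × ℝ)} (hC : OminusChain C) {p q : ℝ × ℝ}
    (hp : p ∈ C) (hq : q ∈ C) (h : p.1 - p.2 = q.1 - q.2) : p = q :=
  (hC.leOminus_of_sub_le hp hq h.le).antisymm (hC.leOminus_of_sub_le hq hp h.ge)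

theorem OminusChain.dist_le {C : Set (ℝ × ℝ)} (hC : OminusChain C) {p q : ℝ × ℝ}
    (hp : p ∈ C) (hq : q ∈ C) : dist p q ≤ dist (p.1 - p.2) (q.1 - q.2) := by
  rw [Prod.dist_eq, Real.dist_eq, Real.dist_eq, Real.dist_eq]
  have key : ∀ {a b : ℝ × ℝ}, leOminus a b →
      max |a.1 - b.1| |a.2 - b.2| ≤ |a.1 - a.2 - (b.1 - b.2)| := by
    rintro a b ⟨h1, h2⟩
    rw [abs_of_nonpos (by linarith : a.1 - b.1 ≤ 0), abs_of_nonneg (by linarith : 0 ≤ a.2 - b.2),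
      abs_of_nonpos (by linarith : a.1 - a.2 - (b.1 - b.2) ≤ 0)]
    exact max_le (by linarith) (by linarith)
  rcases hC p hp q hq with h | h
  · exact key h
  · rw [abs_sub_comm p.1, abs_sub_comm p.2, abs_sub_comm (p.1 - p.2)]
    exact key h

theorem OminusChain.closure {C : Set (ℝ × ℝ)} (hC : OminusChain C) :
    OminusChain (closure C) := by
  have hcl : IsClosed {x : (ℝ × ℝ) × (ℝ × ℝ) | leOminus x.1 x.2 ∨ leOminus x.2 x.1} := by
    unfold leOminus
    have h1 : Continuous fun x : (ℝ × ℝ) × (ℝ × ℝ) => x.1.1 := by fun_prop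
    have h2 : Continuous fun x : (ℝ × ℝ) × (ℝ × ℝ) => x.1.2 := by fun_prop
    have h3 : Continuous fun x : (ℝ × ℝ) × (ℝ × ℝ) => x.2.1 := by fun_prop
    have h4 : Continuous fun x : (ℝ × ℝ) × (ℝ × ℝ) => x.2.2 := by fun_prop
    exact ((isClosed_le h1 h3).inter (isClosed_le h4 h2)).union
      ((isClosed_le h3 h1).inter (isClosed_le h2 h4))
  intro p hp q hq
  have hpq : (p, q) ∈ _root_.closure (C ×ˢ C) := by
    rw [closure_prod_eq]
    exact ⟨hp, hq⟩
  exact closure_minimal (fun x hx => hC x.1 hx.1 x.2 hx.2) hcl hpq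

end OminusOrder

section Interpolation

variable {G : Set (ℝ × ℝ)}

/-- The points of `closure G` lying between two points of `G`. -/
def innerClosure (G : Set (ℝ × ℝ)) : Set (ℝ × ℝ) :=
  {r | r ∈ closure G ∧ ∃ p ∈ G, ∃ q ∈ G, leOminus p r ∧ leOminus r q}

/-- The set `C` together with the segments bridging its gaps. -/
def bridge (C : Set (ℝ × ℝ)) : Set (ℝ × ℝ) :=
  {r | ∃ a ∈ C, ∃ b ∈ C, leOminus a b ∧ (∀ e ∈ C, leOminus e a ∨ leOminus b e) ∧
    r ∈ segment ℝ a b}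

theorem subset_innerClosure : G ⊆ innerClosure G := fun p hp =>
  ⟨subset_closure hp, p, hp, p, hp, ⟨le_rfl, le_rfl⟩, ⟨le_rfl, le_rfl⟩⟩

theorem OminusChain.innerClosure (hG : OminusChain G) : OminusChain (innerClosure G) :=
  fun p hp q hq => hG.closure p hp.1 q hq.1

theorem OminusChain.subset_bridge {C : Set (ℝ × ℝ)} (hC : OminusChain C) : C ⊆ bridge C :=
  fun p hp => ⟨p, hp, p, hp, ⟨le_rfl, le_rfl⟩, fun e he => hC e he p hp, left_mem_segment ℝ p p⟩

theorem ominusChain_bridge (C : Set (ℝ × ℝ)) : OminusChain (bridge C) := by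
  rintro r ⟨a, ha, b, hb, hab, hgap, hr⟩ r' ⟨a', ha', b', hb', hab', hgap', hr'⟩
  have hlt : leOminus b a' → leOminus r r' := fun h =>
    (hab.right_of_mem_segment hr).trans (h.trans (hab'.left_of_mem_segment hr'))
  have hgt : leOminus b' a → leOminus r' r := fun h =>
    (hab'.right_of_mem_segment hr').trans (h.trans (hab.left_of_mem_segment hr))
  rcases hgap a' ha' with h1 | h1
  swap
  · exact Or.inl (hlt h1)
  rcases hgap' a ha with h2 | h2
  swap
  · exact Or.inr (hgt h2)
  obtain rfl := h1.antisymm h2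
  rcases hgap b' hb' with h3 | h3
  · exact Or.inr (hgt h3)
  rcases hgap' b hb with h4 | h4
  · exact Or.inl (hlt h4)
  obtain rfl := h3.antisymm h4
  exact hab.ominusChain_segment r hr r' hr'

theorem bridge_subset_of_convex {C D : Set (ℝ × ℝ)} (hD : Convex ℝ D) (h : C ⊆ D) :
    bridge C ⊆ D := by
  rintro r ⟨a, ha, b, hb, -, -, hr⟩
  exact hD.segment_subset (h ha) (h hb) hr

theorem exists_mem_bridge (hG : OminusChain G) {p q : ℝ × ℝ} (hp : p ∈ G) (hq : q ∈ G) {t : ℝ}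
    (hpt : p.1 - p.2 ≤ t) (htq : t ≤ q.1 - q.2) :
    ∃ r ∈ bridge (innerClosure G), r.1 - r.2 = t := by
  have hC := hG.closure
  have hpq : leOminus p q := hG.leOminus_of_sub_le hp hq (hpt.trans htq)
  have hbetween : ∀ r ∈ closure G, leOminus p r → leOminus r q → r ∈ innerClosure G :=
    fun r hr h1 h2 => ⟨hr, p, hp, q, hq, h1, h2⟩
  have hK : IsCompact (closure G ∩ Set.Icc (p.1, q.2) (q.1, p.2)) :=
    isCompact_Icc.inter_left isClosed_closure
  have hcont : Continuous fun r : ℝ × ℝ => r.1 - r.2 := by fun_prop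
  have hpC : p ∈ closure G := subset_closure hp
  have hqC : q ∈ closure G := subset_closure hq
  obtain ⟨a, ⟨⟨haC, haI⟩, hat⟩, hamax⟩ :=
    (hK.inter_right (isClosed_le hcont continuous_const)).exists_isMaxOn
      ⟨p, ⟨hpC, ⟨le_rfl, hpq.2⟩, ⟨hpq.1, le_rfl⟩⟩, hpt⟩ hcont.continuousOn
  obtain ⟨b, ⟨⟨hbC, hbI⟩, htb⟩, hbmin⟩ :=
    (hK.inter_right (isClosed_le continuous_const hcont)).exists_isMinOn
      ⟨q, ⟨hqC, ⟨hpq.1, le_rfl⟩, ⟨le_rfl, hpq.2⟩⟩, htq⟩ hcont.continuousOn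
  have hpa : leOminus p a := ⟨haI.1.1, haI.2.2⟩
  have haq : leOminus a q := ⟨haI.2.1, haI.1.2⟩
  have hpb : leOminus p b := ⟨hbI.1.1, hbI.2.2⟩
  have hbq : leOminus b q := ⟨hbI.2.1, hbI.1.2⟩
  have hab : leOminus a b := hC.leOminus_of_sub_le haC hbC (le_trans hat htb)
  have hgap : ∀ e ∈ innerClosure G, leOminus e a ∨ leOminus b e := by
    rintro e ⟨heC, -⟩
    rcases le_total (e.1 - e.2) t with het | hte
    · left
      rcases hC p hpC e heC with h | h
      · have heq := hC.leOminus_of_sub_le heC hqC (het.trans htq)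
        exact hC.leOminus_of_sub_le heC haC
          (hamax ⟨⟨heC, ⟨h.1, heq.2⟩, ⟨heq.1, h.2⟩⟩, het⟩)
      · exact h.trans hpa
    · right
      rcases hC e heC q hqC with h | h
      · have hpe := hC.leOminus_of_sub_le hpC heC (hpt.trans hte)
        exact hC.leOminus_of_sub_le hbC heC
          (hbmin ⟨⟨heC, ⟨hpe.1, h.2⟩, ⟨h.1, hpe.2⟩⟩, hte⟩)
      · exact hbq.trans h
  have hsurj : t ∈ (fun r : ℝ × ℝ => r.1 - r.2) '' segment ℝ a b :=
    (convex_segment a b).isPreconnected.intermediate_value (left_mem_segment ℝ a b)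
      (right_mem_segment ℝ a b) hcont.continuousOn ⟨hat, htb⟩
  obtain ⟨r, hr, hrt⟩ := hsurj
  exact ⟨r, ⟨a, hbetween a haC hpa haq, b, hbetween b hbC hpb hbq, hab, hgap, hr⟩, hrt⟩

theorem isPreconnected_bridge (hG : OminusChain G) :
    IsPreconnected (bridge (innerClosure G)) := by
  set S := bridge (innerClosure G) with hS
  have hSchain : OminusChain S := ominusChain_bridge _
  set I : Set ℝ := (fun r : ℝ × ℝ => r.1 - r.2) '' S with hI
  have hIconn : I.OrdConnected := by
    refine ⟨?_⟩
    rintro _ ⟨r, ⟨a, ⟨-, p, hp, -, -, hpa, -⟩, b, -, hab, -, hr⟩, rfl⟩ _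
      ⟨r', ⟨a', -, b', ⟨-, -, -, q, hq, -, hbq⟩, hab', -, hr'⟩, rfl⟩ t ⟨h1, h2⟩
    exact exists_mem_bridge hG hp hq
      ((hpa.trans (hab.left_of_mem_segment hr)).sub_le_sub.trans h1)
      (h2.trans ((hab'.right_of_mem_segment hr').trans hbq).sub_le_sub)
  choose! g hgS hg using fun t (ht : t ∈ I) => ht
  have hlip : LipschitzOnWith 1 g I := LipschitzOnWith.of_dist_le_mul fun s hs t ht => by
    have := hSchain.dist_le (hgS s hs) (hgS t ht)
    simp only at hg
    rw [hg s hs, hg t ht] at this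
    simpa using this
  have himage : g '' I = S := by
    refine Set.Subset.antisymm (Set.image_subset_iff.2 hgS) fun r hr => ?_
    have hrI : r.1 - r.2 ∈ I := ⟨r, hr, rfl⟩
    exact ⟨_, hrI, hSchain.eq_of_sub_eq (hgS _ hrI) hr (hg _ hrI)⟩
  rw [← himage]
  exact hIconn.isPreconnected.image g hlip.continuousOn

end Interpolation

section Monotone

variable {c : ℝ × ℝ → EReal}

theorem OminusMonotone.swap (hbot : ∀ p, c p ≠ ⊥) (hmono : OminusMonotone c) {p q : ℝ × ℝ}
    (hp : p ∈ Dom c) (hq : q ∈ Dom c) (h : ¬ (leOminus p q ∨ leOminus q p)) :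
    (q.1, p.2) ∈ Dom c ∧ (p.1, q.2) ∈ Dom c ∧
      (c (q.1, p.2)).toReal + (c (p.1, q.2)).toReal < (c p).toReal + (c q).toReal := by
  have hpos := mt (hmono p q hp hq) h
  have hcp : ((c p).toReal : EReal) = c p := EReal.coe_toReal hp.ne (hbot p)
  have hcq : ((c q).toReal : EReal) = c q := EReal.coe_toReal hq.ne (hbot q)
  have h1 : c (q.1, p.2) ≠ ⊤ := by
    intro h1
    apply hpos
    rw [h1, EReal.sub_top, EReal.bot_add]
    exact bot_le
  have h2 : c (p.1, q.2) ≠ ⊤ := by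
    intro h2
    apply hpos
    rw [h2, EReal.sub_top, EReal.add_bot]
    exact bot_le
  refine ⟨lt_top_iff_ne_top.2 h1, lt_top_iff_ne_top.2 h2, ?_⟩
  rw [← hcp, ← hcq, ← EReal.coe_toReal h1 (hbot _), ← EReal.coe_toReal h2 (hbot _)] at hpos
  norm_cast at hpos
  linarith

/-- A weak exchange inequality for opposite corners of a rectangle. -/
theorem OminusMonotone.exchange (hbot : ∀ p, c p ≠ ⊥) (hmono : OminusMonotone c)
    {x u v y : ℝ} (hxu : x ≤ u) (hvy : v ≤ y) (h1 : c (x, v) < ⊤) (h2 : c (u, y) < ⊤) :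
    c (x, y) < ⊤ ∧
      (c (u, v)).toReal + (c (x, y)).toReal ≤ (c (u, y)).toReal + (c (x, v)).toReal := by
  rcases hxu.eq_or_lt with rfl | hxu
  · exact ⟨h2, by linarith⟩
  rcases hvy.eq_or_lt with rfl | hvy
  · exact ⟨h1, le_rfl⟩
  obtain ⟨-, h, hlt⟩ := hmono.swap hbot (p := (x, v)) (q := (u, y)) h1 h2
    (by rintro (h | h); exacts [hvy.not_ge h.2, hxu.not_ge h.1])
  exact ⟨h, by simp only at hlt; linarith⟩

/-- The pairing of a finite chain with itself is the cheapest one. -/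
theorem OminusMonotone.sum_le_sum_perm (hbot : ∀ p, c p ≠ ⊥) (hmono : OminusMonotone c)
    {S : Set (ℝ × ℝ)} (hS : OminusChain S) {ι : Type*} [DecidableEq ι] (s : Finset ι)
    (z : ι → ℝ × ℝ) (hz : ∀ i, z i ∈ S) (σ : Equiv.Perm ι) (hσ : {i | σ i ≠ i} ⊆ s)
    (hfin : ∀ i ∈ s, c ((z (σ i)).1, (z i).2) < ⊤) :
    ∑ i ∈ s, (c (z i)).toReal ≤ ∑ i ∈ s, (c ((z (σ i)).1, (z i).2)).toReal := by
  induction s using Finset.induction_on_max_value (fun i => (z i).1 - (z i).2)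
    generalizing σ with
  | empty => simp
  | insert a s has hmax ih =>
    have hle : ∀ i ∈ insert a s, leOminus (z i) (z a) := fun i hi =>
      hS.leOminus_of_sub_le (hz i) (hz a) (by
        rcases Finset.mem_insert.1 hi with rfl | hi
        exacts [le_rfl, hmax i hi])
    have hmaps : ∀ i ∈ insert a s, σ i ∈ insert a s := fun i hi => by
      by_cases h : σ i = i
      · rwa [h]
      · exact hσ fun h' => h (σ.injective h')
    by_cases hfix : σ a = a
    · rw [Finset.sum_insert has, Finset.sum_insert has, hfix]
      refine add_le_add_right (ih σ (fun i hi => ?_) fun i hi =>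
        hfin i (Finset.mem_insert_of_mem hi)) _
      refine (Finset.mem_insert.1 (hσ hi)).resolve_left ?_
      rintro rfl
      exact hi hfix
    · set b := σ.symm a with hb
      have hσb : σ b = a := σ.apply_symm_apply a
      have hba : b ≠ a := fun h => hfix (h ▸ hσb)
      have hbs : b ∈ s :=
        (Finset.mem_insert.1 (hσ fun h => hba (h.symm.trans hσb))).resolve_left hba
      have hbi : b ∈ insert a s := Finset.mem_insert_of_mem hbs
      set τ : Equiv.Perm ι := σ.trans (Equiv.swap a (σ a)) with hτ
      have hτa : τ a = a := by simp [hτ]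
      have hτb : τ b = σ a := by simp [hτ, hσb]
      have hτo : ∀ i, i ≠ a → i ≠ b → τ i = σ i := fun i hia hib => by
        simp only [hτ, Equiv.trans_apply]
        refine Equiv.swap_apply_of_ne_of_ne (fun h => hib ?_) fun h => hia (σ.injective h)
        exact σ.injective (h.trans hσb.symm)
      obtain ⟨hfin', hexch⟩ := hmono.exchange hbot
        (hle _ (hmaps a (Finset.mem_insert_self a s))).1 (hle b hbi).2
        (hfin a (Finset.mem_insert_self a s)) (by simpa [hσb] using hfin b hbi)
      have hI := ih τ (fun i hi => by
          have hia : i ≠ a := by rintro rfl; exact hi hτa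
          by_cases hib : i = b
          · exact hib ▸ hbs
          · exact (Finset.mem_insert.1 (hσ (by
              intro h; exact hi ((hτo i hia hib).trans h)))).resolve_left hia)
        (fun i hi => by
          have hia : i ≠ a := by rintro rfl; exact has hi
          by_cases hib : i = b
          · rw [hib, hτb]; exact hfin'
          · rw [hτo i hia hib]; exact hfin i (Finset.mem_insert_of_mem hi))
      rw [Finset.sum_insert has, Finset.sum_insert has]
      rw [← Finset.add_sum_erase s _ hbs] at hI ⊢
      rw [← Finset.add_sum_erase s (fun i => (c ((z (τ i)).1, (z i).2)).toReal) hbs] at hI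
      rw [← Finset.add_sum_erase s (fun i => (c ((z (σ i)).1, (z i).2)).toReal) hbs]
      have heq : ∑ i ∈ s.erase b, (c ((z (τ i)).1, (z i).2)).toReal =
          ∑ i ∈ s.erase b, (c ((z (σ i)).1, (z i).2)).toReal :=
        Finset.sum_congr rfl fun i hi => by
          rw [hτo i (by rintro rfl; exact has (Finset.mem_of_mem_erase hi))
            (Finset.ne_of_mem_erase hi)]
      rw [heq] at hI
      simp only [hτb, hσb] at hI ⊢
      simp only [Prod.mk.eta] at hexch
      linarith

/-- Closed paths in a chain have nonpositive inner variation. -/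
theorem OminusMonotone.isPathValue_nonpos (hbot : ∀ p, c p ≠ ⊥) (hmono : OminusMonotone c)
    {S : Set (ℝ × ℝ)} (hS : OminusChain S) {p : ℝ × ℝ} {s : ℝ}
    (h : IsPathValue c S p p s) : s ≤ 0 := by
  obtain ⟨N, z, ⟨hzS, h0, hl, hstep⟩, rfl⟩ := h
  rcases N with _ | N
  · simp [pathSum]
  have hrot : ∀ i : Fin (N + 1), z (finRotate (N + 1) i).castSucc = z i.succ := by
    intro i
    cases i using Fin.lastCases with
    | last => rw [finRotate_last, Fin.castSucc_zero, Fin.succ_last, h0, hl]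
    | cast i => rw [finRotate_apply, Fin.coeSucc_eq_succ, Fin.succ_castSucc]
  have := hmono.sum_le_sum_perm hbot hS Finset.univ (fun i => z i.castSucc) (fun i => hzS _)
    (finRotate (N + 1)) (by simp) (fun i _ => by simpa only [hrot] using hstep i)
  simp only [hrot] at this
  rw [pathSum, Finset.sum_sub_distrib]
  linarith

theorem OminusMonotone.pathBounded (hbot : ∀ p, c p ≠ ⊥) (hmono : OminusMonotone c)
    {S : Set (ℝ × ℝ)} (hS : OminusChain S)
    (hconn : ∀ p ∈ S, ∀ q ∈ S, StronglyConn c S p q) : PathBounded c S := by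
  intro p hp q hq
  obtain ⟨-, N, z, hz⟩ := hconn p hp q hq
  refine innerVar_lt_top_iff.2 ⟨-pathSum c z, fun s hs => ?_⟩
  have := hmono.isPathValue_nonpos hbot hS (IsPathValue.trans hs ⟨N, z, hz, rfl⟩)
  linarith

theorem OminusMonotone.ominusChain (hbot : ∀ p, c p ≠ ⊥) (hmono : OminusMonotone c)
    {G : Set (ℝ × ℝ)} (hD : G ⊆ Dom c) (hpb : PathBounded c G) : OminusChain G := by
  intro p hp q hq
  by_contra hcon
  obtain ⟨h1, h2, hlt⟩ := hmono.swap hbot (hD hp) (hD hq) hcon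
  have := hpb.nonpos hp ((IsPathValue.step hp hq h1).trans (IsPathValue.step hq hp h2))
  linarith

end Monotone

section Boundary

variable {c : ℝ × ℝ → EReal} {G : Set (ℝ × ℝ)}

theorem ball2_mem_nhds (p : ℝ × ℝ) {δ : ℝ} (hδ : 0 < δ) : ball2 p δ ∈ nhds p := by
  have hcont : Continuous (dist2 p) := by
    unfold dist2
    fun_prop
  exact hcont.continuousAt.eventually_lt continuousAt_const (by simpa [dist2] using hδ)

theorem eventually_le_of_mem_dom
    (hloc : ∀ p ∈ Dom c, ∃ δ : ℝ, 0 < δ ∧ ∃ M : ℝ, ∀ q ∈ ball2 p δ, c q ≤ (M : EReal))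
    {p : ℝ × ℝ} (hp : p ∈ Dom c) : ∃ M : ℝ, ∀ᶠ q in nhds p, c q ≤ (M : EReal) := by
  obtain ⟨δ, hδ, M, hM⟩ := hloc p hp
  exact ⟨M, Filter.mem_of_superset (ball2_mem_nhds p hδ) hM⟩

theorem isOpen_dom
    (hloc : ∀ p ∈ Dom c, ∃ δ : ℝ, 0 < δ ∧ ∃ M : ℝ, ∀ q ∈ ball2 p δ, c q ≤ (M : EReal)) :
    IsOpen (Dom c) := by
  refine isOpen_iff_mem_nhds.2 fun p hp => ?_
  obtain ⟨M, hM⟩ := eventually_le_of_mem_dom hloc hp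
  filter_upwards [hM] with q hq using hq.trans_lt (EReal.coe_lt_top M)

/-- The cost cannot blow up along a sequence in `G` converging to `b` if paths in `G` from `p`
to `q` can detour through points near `b`. -/
theorem not_tendsto_top_of_step
    (hloc : ∀ p ∈ Dom c, ∃ δ : ℝ, 0 < δ ∧ ∃ M : ℝ, ∀ q ∈ ball2 p δ, c q ≤ (M : EReal))
    (hbot : ∀ p, c p ≠ ⊥) (hD : G ⊆ Dom c) (hpb : PathBounded c G)
    {p q b : ℝ × ℝ} (hp : p ∈ G) (hq : q ∈ G)
    (hpb' : (b.1, p.2) ∈ Dom c) (hbq : (q.1, b.2) ∈ Dom c)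
    {u : ℕ → ℝ × ℝ} (hu : ∀ n, u n ∈ G) (hub : Filter.Tendsto u Filter.atTop (nhds b)) :
    ¬ Filter.Tendsto (fun n => c (u n)) Filter.atTop (nhds (⊤ : EReal)) := by
  intro htop
  obtain ⟨M₁, hM₁⟩ := eventually_le_of_mem_dom hloc hpb'
  obtain ⟨M₂, hM₂⟩ := eventually_le_of_mem_dom hloc hbq
  obtain ⟨M, hM⟩ := innerVar_lt_top_iff.1 (hpb p hp q hq)
  have ht₁ : Filter.Tendsto (fun n => ((u n).1, p.2)) Filter.atTop (nhds (b.1, p.2)) :=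
    (hub.fst_nhds).prodMk_nhds tendsto_const_nhds
  have ht₂ : Filter.Tendsto (fun n => (q.1, (u n).2)) Filter.atTop (nhds (q.1, b.2)) :=
    tendsto_const_nhds.prodMk_nhds hub.snd_nhds
  have hbig := htop.eventually
    (lt_mem_nhds (EReal.coe_lt_top (M + M₁ + M₂ - (c p).toReal)))
  obtain ⟨n, h1, h2, h3⟩ :=
    ((ht₁.eventually hM₁).and ((ht₂.eventually hM₂).and hbig)).exists
  have hreal : ∀ {r : ℝ × ℝ} {m : ℝ}, c r ≤ m → (c r).toReal ≤ m := fun {r m} h => by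
    rwa [← EReal.coe_le_coe_iff, EReal.coe_toReal (h.trans_lt (EReal.coe_lt_top m)).ne (hbot r)]
  have hval := hM ((IsPathValue.step hp (hu n) (h1.trans_lt (EReal.coe_lt_top _))).trans
    (IsPathValue.step (hu n) hq (h2.trans_lt (EReal.coe_lt_top _))))
  rw [← EReal.coe_toReal (hD (hu n)).ne (hbot _), EReal.coe_lt_coe_iff] at h3
  have h1' := hreal h1
  have h2' := hreal h2
  linarith

/-- Limit points of `G` lying between points of `G` stay in the domain of the cost. -/
theorem innerClosure_subset_dom (hbot : ∀ p, c p ≠ ⊥) (hconv : Convex ℝ (Dom c))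
    (hloc : ∀ p ∈ Dom c, ∃ δ : ℝ, 0 < δ ∧ ∃ M : ℝ, ∀ q ∈ ball2 p δ, c q ≤ (M : EReal))
    (hbdry : ∀ p ∈ frontier (Dom c), ∀ u : ℕ → ℝ × ℝ,
      Filter.Tendsto u Filter.atTop (nhds p) →
      Filter.Tendsto (fun k => c (u k)) Filter.atTop (nhds (⊤ : EReal)))
    (hD : G ⊆ Dom c) (hG : OminusChain G) (hpb : PathBounded c G)
    (hpart : ∀ S₁ S₂ : Set (ℝ × ℝ), S₁.Nonempty → S₂.Nonempty →
      S₁ ∪ S₂ = G → Disjoint S₁ S₂ →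
      ∃ p ∈ S₁, ∃ q ∈ S₂,
        (∃ (N : ℕ) (z : Fin (N + 1) → ℝ × ℝ), IsPath c G p q N z) ∨
        (∃ (N : ℕ) (z : Fin (N + 1) → ℝ × ℝ), IsPath c G q p N z)) :
    innerClosure G ⊆ Dom c := by
  rintro b ⟨hbG, p₀, hp₀, q₀, hq₀, hpb₀, hbq₀⟩
  by_contra hbD
  have hfr : b ∈ frontier (Dom c) := by
    rw [(isOpen_dom hloc).frontier_eq]
    exact ⟨closure_mono hD hbG, hbD⟩
  obtain ⟨u, hu, hub⟩ := mem_closure_iff_seq_limit.1 hbG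
  have hC := hG.closure
  have hne : ∀ p ∈ G, ¬ (leOminus p b ∧ leOminus b p) := fun p hp h =>
    hbD (h.1.antisymm h.2 ▸ hD hp)
  have hcomp : ∀ p ∈ G, leOminus p b ∨ leOminus b p := fun p hp =>
    hC p (subset_closure hp) b hbG
  have hseg : ∀ p ∈ G, ∀ q ∈ G, (q.1, p.2) ∈ Dom c → b.1 ∈ Set.uIcc p.1 q.1 →
      b.2 ∈ Set.uIcc p.2 q.2 → False := by
    intro p hp q hq hpq h1 h2
    rw [← segment_eq_uIcc] at h1 h2
    refine not_tendsto_top_of_step hloc hbot hD hpb hp hq ?_ ?_ hu hub (hbdry b hfr u hub)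
    · refine hconv.segment_subset (hD hp) hpq ?_
      rw [← Prod.image_mk_segment_left]
      exact ⟨b.1, h1, rfl⟩
    · refine hconv.segment_subset hpq (hD hq) ?_
      rw [← Prod.image_mk_segment_right]
      exact ⟨b.2, h2, rfl⟩
  obtain ⟨p, ⟨-, hp⟩, q, ⟨-, hq⟩, hpath⟩ := hpart {p | p ∈ G ∧ leOminus p b}
    {p | p ∈ G ∧ ¬ leOminus p b} ⟨p₀, hp₀, hpb₀⟩ ⟨q₀, hq₀, fun h => hne q₀ hq₀ ⟨h, hbq₀⟩⟩
    (by ext r; simp only [Set.mem_union, Set.mem_ofPred_eq]; tauto)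
    (Set.disjoint_left.2 fun r h h' => h'.2 h.2)
  rcases hpath with ⟨N, z, hz⟩ | ⟨N, z, hz⟩
  · obtain ⟨p, hpG, q, hqG, hpA, hqA, hpq⟩ :=
      hz.exists_step_notMem (A := {r | leOminus r b}) hp hq
    have hq' := (hcomp q hqG).resolve_left hqA
    exact hseg p hpG q hqG hpq (Set.mem_uIcc.2 (Or.inl ⟨hpA.1, hq'.1⟩))
      (Set.mem_uIcc.2 (Or.inr ⟨hq'.2, hpA.2⟩))
  · obtain ⟨p, hpG, q, hqG, hpA, hqA, hpq⟩ :=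
      hz.exists_step_notMem (A := {r | ¬ leOminus r b}) hq (not_not.2 hp)
    have hp' := (hcomp p hpG).resolve_left hpA
    have hq' : leOminus q b := not_not.1 hqA
    exact hseg p hpG q hqG hpq (Set.mem_uIcc.2 (Or.inr ⟨hq'.1, hp'.1⟩))
      (Set.mem_uIcc.2 (Or.inl ⟨hp'.2, hq'.2⟩))

/-- A preconnected set in an open domain is strongly connected. -/
theorem stronglyConn_of_isPreconnected {S : Set (ℝ × ℝ)} (hopen : IsOpen (Dom c))
    (hSD : S ⊆ Dom c) (hS : IsPreconnected S) : ∀ p ∈ S, ∀ q ∈ S, StronglyConn c S p q := by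
  intro p hp q hq
  refine hS.induction₂ (StronglyConn c S) (fun r hr => ?_) (fun _ _ _ _ _ _ => StronglyConn.trans)
    (fun _ _ _ _ => StronglyConn.symm) hp hq
  have h1 : ∀ᶠ w in nhds r, (w.1, r.2) ∈ Dom c :=
    (show Continuous fun w : ℝ × ℝ => (w.1, r.2) by fun_prop).continuousAt.eventually_mem
      (hopen.mem_nhds (hSD hr))
  have h2 : ∀ᶠ w in nhds r, (r.1, w.2) ∈ Dom c :=
    (show Continuous fun w : ℝ × ℝ => (r.1, w.2) by fun_prop).continuousAt.eventually_mem
      (hopen.mem_nhds (hSD hr))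
  filter_upwards [self_mem_nhdsWithin, nhdsWithin_le_nhds h1, nhdsWithin_le_nhds h2]
    with w hw h1 h2 using StronglyConn.step hr hw h1 h2

end Boundary

/-- a `⊖`-monotone cost on `ℝ × ℝ` with convex domain, locally bounded
above on its domain, and blowing up at the boundary of its domain, and a nonempty
`c`-path bounded `G ⊆ Dom c` such that any two pieces of any partition of `G` are joined
by some path: then `G` has a strongly connected `c`-path bounded extension inside `Dom c`,
and `G` has a `c`-antiderivative. -/
theorem pathBounded_extension (c : ℝ × ℝ → EReal) (hbot : ∀ p, c p ≠ ⊥)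
    (hconv : Convex ℝ (Dom c))
    (hmono : OminusMonotone c)
    (hloc : ∀ p ∈ Dom c, ∃ δ : ℝ, 0 < δ ∧ ∃ M : ℝ, ∀ q ∈ ball2 p δ, c q ≤ (M : EReal))
    (hbdry : ∀ p ∈ frontier (Dom c), ∀ u : ℕ → ℝ × ℝ,
      Filter.Tendsto u Filter.atTop (nhds p) →
      Filter.Tendsto (fun k => c (u k)) Filter.atTop (nhds (⊤ : EReal)))
    (G : Set (ℝ × ℝ)) (hne : G.Nonempty) (hGD : G ⊆ Dom c)
    (hpb : PathBounded c G)
    (hpart : ∀ S₁ S₂ : Set (ℝ × ℝ), S₁.Nonempty → S₂.Nonempty →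
      S₁ ∪ S₂ = G → Disjoint S₁ S₂ →
      ∃ p ∈ S₁, ∃ q ∈ S₂,
        (∃ (N : ℕ) (z : Fin (N + 1) → ℝ × ℝ), IsPath c G p q N z) ∨
        (∃ (N : ℕ) (z : Fin (N + 1) → ℝ × ℝ), IsPath c G q p N z)) :
    (∃ S : Set (ℝ × ℝ), G ⊆ S ∧ S ⊆ Dom c ∧ PathBounded c S ∧
        ∀ p ∈ S, ∀ q ∈ S, StronglyConn c S p q) ∧
      ∃ f : ℝ × ℝ → ℝ, IsAntideriv c G f := by
  have hG : OminusChain G := hmono.ominusChain hbot hGD hpb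
  have hGS : G ⊆ bridge (innerClosure G) :=
    subset_innerClosure.trans hG.innerClosure.subset_bridge
  have hSD : bridge (innerClosure G) ⊆ Dom c := bridge_subset_of_convex hconv
    (innerClosure_subset_dom hbot hconv hloc hbdry hGD hG hpb hpart)
  have hconn := stronglyConn_of_isPreconnected (isOpen_dom hloc) hSD (isPreconnected_bridge hG)
  have hSpb := hmono.pathBounded hbot (ominusChain_bridge _) hconn
  obtain ⟨f, hf⟩ := exists_isAntideriv hbot hSD hSpb hconn
  exact ⟨⟨_, hGS, hSD, hSpb, hconn⟩, f, fun p hp q hq => hf p (hGS hp) q (hGS hq)⟩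

end Paper
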